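/- There exists a unique unital ℂ-algebra homomorphism Δ : Y(gl_{m|n}) → Y(gl_{m|n}) ⊗ Y(gl_{m|n}) (the ℤ/2-graded tensor square) such that Δ(t_{ij}^{(r)}) = Σ_{k=1}^{m+n} Σ_{a=0}^{r} t_{ik}^{(a)} ⊗ t_{kj}^{(r−a)} for all i, j and r ≥ 1, where t_{ij}^{(0)} := δ_{ij}; equivalently, Δ(t_{ij}(u)) = Σ_{k=1}^{m+n} t_{ik}(u) ⊗ t_{kj}(u). -/

import Mathlib

/-!
STATEMENT 16: There exists a unique unital ℂ-algebra homomorphism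
Δ : Y(gl_{m|n}) → Y(gl_{m|n}) ⊗ Y(gl_{m|n}) (the ℤ/2-graded tensor square) with
Δ(t_{ij}^{(r)}) = Σ_{k} Σ_{a=0}^{r} t_{ik}^{(a)} ⊗ t_{kj}^{(r−a)}  (t^{(0)} = δ).

The graded tensor square is presented by generators and relations: it is generated by
the elements t_{ij}^{(r)} ⊗ 1 (generators `Sum.inl`) and 1 ⊗ t_{ij}^{(r)} (generators
`Sum.inr`), subject to the Yangian relations among each family and to the graded
commutation rule (1⊗y)(x⊗1) = (−1)^{|x||y|} (x⊗1)(1⊗y) for generators x, y; the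
element x ⊗ y is then (x⊗1)(1⊗y).
-/

noncomputable section

/-- parity of the index i ∈ {1,…,m+n}. -/
def par (m : ℕ) {N : ℕ} (i : Fin N) : ℕ := if (i : ℕ) < m then 0 else 1

/-- Index type for the generators t_{ij}^{(r+1)}. -/
abbrev G (m n : ℕ) := Fin (m + n) × Fin (m + n) × ℕ

/-- The free algebra on the generators of Y. -/
abbrev F (m n : ℕ) := FreeAlgebra ℂ (G m n)

/-- t_{ij}^{(p)} in the free algebra (t^{(0)} = δ). -/
def tF (m n : ℕ) (i j : Fin (m + n)) : ℕ → F m n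
  | 0 => if i = j then 1 else 0
  | p + 1 => FreeAlgebra.ι ℂ (i, j, p)

/-- The defining relations of the super Yangian. -/
inductive YRel (m n : ℕ) : F m n → F m n → Prop
  | rel (i j k l : Fin (m + n)) (r s : ℕ) :
      YRel m n
        (tF m n i j (r + 1) * tF m n k l (s + 1)
          - (-1 : F m n) ^ ((par m i + par m j) * (par m k + par m l)) *
              (tF m n k l (s + 1) * tF m n i j (r + 1)))
        ((-1 : F m n) ^ (par m i * par m j + par m i * par m k + par m j * par m k) *
          ∑ a ∈ Finset.range (min (r + 1) (s + 1)),
            (tF m n k j a * tF m n i l (r + s + 1 - a)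
              - tF m n k j (r + s + 1 - a) * tF m n i l a))

/-- The super Yangian Y(gl_{m|n}). -/
abbrev Y (m n : ℕ) := RingQuot (YRel m n)

/-- t_{ij}^{(p)} in the Yangian. -/
def tY (m n : ℕ) (i j : Fin (m + n)) (p : ℕ) : Y m n :=
  RingQuot.mkAlgHom ℂ (YRel m n) (tF m n i j p)

/-- Generators of the graded tensor square: inl = t⊗1, inr = 1⊗t. -/
abbrev G2 (m n : ℕ) := G m n ⊕ G m n

/-- The free algebra on the generators of Y ⊗ Y. -/
abbrev F2 (m n : ℕ) := FreeAlgebra ℂ (G2 m n)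

/-- t_{ij}^{(p)} ⊗ 1 in the free algebra (t^{(0)} = δ). -/
def tL (m n : ℕ) (i j : Fin (m + n)) : ℕ → F2 m n
  | 0 => if i = j then 1 else 0
  | p + 1 => FreeAlgebra.ι ℂ (Sum.inl (i, j, p))

/-- 1 ⊗ t_{ij}^{(p)} in the free algebra (t^{(0)} = δ). -/
def tR (m n : ℕ) (i j : Fin (m + n)) : ℕ → F2 m n
  | 0 => if i = j then 1 else 0
  | p + 1 => FreeAlgebra.ι ℂ (Sum.inr (i, j, p))

/-- The defining relations of the graded tensor square Y ⊗ Y. -/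
inductive YYRel (m n : ℕ) : F2 m n → F2 m n → Prop
  | left (i j k l : Fin (m + n)) (r s : ℕ) :
      YYRel m n
        (tL m n i j (r + 1) * tL m n k l (s + 1)
          - (-1 : F2 m n) ^ ((par m i + par m j) * (par m k + par m l)) *
              (tL m n k l (s + 1) * tL m n i j (r + 1)))
        ((-1 : F2 m n) ^ (par m i * par m j + par m i * par m k + par m j * par m k) *
          ∑ a ∈ Finset.range (min (r + 1) (s + 1)),
            (tL m n k j a * tL m n i l (r + s + 1 - a)
              - tL m n k j (r + s + 1 - a) * tL m n i l a))
  | right (i j k l : Fin (m + n)) (r s : ℕ) :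
      YYRel m n
        (tR m n i j (r + 1) * tR m n k l (s + 1)
          - (-1 : F2 m n) ^ ((par m i + par m j) * (par m k + par m l)) *
              (tR m n k l (s + 1) * tR m n i j (r + 1)))
        ((-1 : F2 m n) ^ (par m i * par m j + par m i * par m k + par m j * par m k) *
          ∑ a ∈ Finset.range (min (r + 1) (s + 1)),
            (tR m n k j a * tR m n i l (r + s + 1 - a)
              - tR m n k j (r + s + 1 - a) * tR m n i l a))
  | mixed (g h : G m n) :
      YYRel m n
        (FreeAlgebra.ι ℂ (Sum.inr h) * FreeAlgebra.ι ℂ (Sum.inl g))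
        ((-1 : F2 m n) ^ ((par m g.1 + par m g.2.1) * (par m h.1 + par m h.2.1)) *
          (FreeAlgebra.ι ℂ (Sum.inl g) * FreeAlgebra.ι ℂ (Sum.inr h)))

/-- The graded tensor square Y(gl_{m|n}) ⊗ Y(gl_{m|n}). -/
abbrev YY (m n : ℕ) := RingQuot (YYRel m n)

/-- The element t_{ik}^{(a)} ⊗ t_{kj}^{(b)} of the graded tensor square. -/
def tensorElem (m n : ℕ) (i k k' j : Fin (m + n)) (a b : ℕ) : YY m n :=
  RingQuot.mkAlgHom ℂ (YYRel m n) (tL m n i k a * tR m n k' j b)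

theorem neg_one_pow_eq_of_even {a b : ℕ} (h : Even (a + b)) : (-1 : ℤ) ^ a = (-1 : ℤ) ^ b := by
  rcases Nat.even_or_odd a with ha | ha
  · rw [ha.neg_one_pow, ((Nat.even_add.1 h).1 ha).neg_one_pow]
  · rw [ha.neg_one_pow, Odd.neg_one_pow]
    rw [← Nat.not_even_iff_odd] at ha ⊢
    exact fun hb => ha ((Nat.even_add.1 h).2 hb)

section RTT

variable {ι B : Type*} [Fintype ι] [Ring B] (p : ι → ℕ)

/-- The product of two entries of the matrix products `a * b` and `a' * b'`, when the entries of
`b` and `a'` supercommute. -/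
theorem sum_mul_sum_of_supercommute {a b a' b' : ι → ι → B}
    (h : ∀ i j k l, b i j * a' k l = (-1 : ℤ) ^ ((p i + p j) * (p k + p l)) • (a' k l * b i j))
    (i j k l : ι) :
    (∑ x, a i x * b x j) * (∑ y, a' k y * b' y l) =
      ∑ x, ∑ y, (-1 : ℤ) ^ ((p x + p j) * (p k + p y)) •
        (a i x * a' k y * (b x j * b' y l)) := by
  rw [Finset.sum_mul_sum]
  refine Finset.sum_congr rfl fun x _ => Finset.sum_congr rfl fun y _ => ?_
  rw [mul_assoc (a i x), ← mul_assoc (b x j), h]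
  simp only [smul_mul_assoc, mul_smul_comm, mul_assoc]

/-- The RTT relation with spectral parameters encoded by `w` and `z`, for a matrix `a` at the
first parameter and a matrix `a'` at the second one. -/
def RTT (w z : B) (a a' : ι → ι → B) : Prop :=
  ∀ i j k l, w * (a i j * a' k l) -
      (-1 : ℤ) ^ (p i * p j + p i * p k + p j * p k) • (z * (a k j * a' i l)) =
    (-1 : ℤ) ^ ((p i + p j) * (p k + p l)) • (w * (a' k l * a i j)) -
      (-1 : ℤ) ^ (p i * p j + p i * p k + p j * p k) • (z * (a' k j * a i l))

/-- Products of supercommuting solutions of the RTT relation are solutions. -/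
theorem RTT.mul {w z : B} (hw : ∀ x, w * x = x * w) (hz : ∀ x, z * x = x * z)
    {a a' b b' : ι → ι → B} (ha : RTT p w z a a') (hb : RTT p w z b b')
    (h : ∀ i j k l, b i j * a' k l = (-1 : ℤ) ^ ((p i + p j) * (p k + p l)) • (a' k l * b i j))
    (h' : ∀ i j k l,
      b' i j * a k l = (-1 : ℤ) ^ ((p i + p j) * (p k + p l)) • (a k l * b' i j)) :
    RTT p w z (fun i j => ∑ x, a i x * b x j) (fun i j => ∑ x, a' i x * b' x j) := by
  intro i j k l
  have hl : w * ((∑ x, a i x * b x j) * (∑ y, a' k y * b' y l)) -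
      (-1 : ℤ) ^ (p i * p j + p i * p k + p j * p k) •
        (z * ((∑ x, a k x * b x j) * (∑ y, a' i y * b' y l))) =
      ∑ x, ∑ y, (-1 : ℤ) ^ ((p x + p j) * (p k + p y)) •
        (((-1 : ℤ) ^ ((p i + p x) * (p k + p y)) • (w * (a' k y * a i x)) -
          (-1 : ℤ) ^ (p i * p x + p i * p k + p x * p k) • (z * (a' k x * a i y))) *
          (b x j * b' y l)) := by
    simp only [sum_mul_sum_of_supercommute p h, Finset.mul_sum, Finset.smul_sum,
      ← Finset.sum_sub_distrib, ← ha i _ k _]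
    refine Finset.sum_congr rfl fun x _ => Finset.sum_congr rfl fun y _ => ?_
    simp only [sub_mul, smul_sub, smul_mul_assoc, mul_smul_comm, smul_smul, mul_assoc, ← pow_add]
    congr 2
    refine neg_one_pow_eq_of_even ⟨p i * p j + p i * p k + p j * p k + p x * p i + p x * p y +
      p j * p y + p x * p k, by ring⟩
  have hr : (-1 : ℤ) ^ ((p i + p j) * (p k + p l)) •
        (w * ((∑ y, a' k y * b' y l) * (∑ x, a i x * b x j))) -
      (-1 : ℤ) ^ (p i * p j + p i * p k + p j * p k) •
        (z * ((∑ y, a' k y * b' y j) * (∑ x, a i x * b x l))) =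
      ∑ y, ∑ x, (-1 : ℤ) ^ ((p i + p j) * (p k + p y)) •
        ((a' k y * a i x) * (w * (b x j * b' y l) -
          (-1 : ℤ) ^ (p x * p j + p x * p y + p j * p y) • (z * (b y j * b' x l)))) := by
    simp only [sum_mul_sum_of_supercommute p h', Finset.mul_sum, Finset.smul_sum,
      ← Finset.sum_sub_distrib, hb _ j _ l]
    refine Finset.sum_congr rfl fun y _ => Finset.sum_congr rfl fun x _ => ?_
    simp only [mul_sub, smul_sub, mul_smul_comm, smul_smul, ← pow_add]
    rw [← mul_assoc _ w, ← hw, ← mul_assoc _ z, ← hz]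
    simp only [mul_assoc]
    congr 2
    · refine neg_one_pow_eq_of_even ⟨p i * p k + p i * p l + p j * p k + p j * p l + p y * p i +
        p y * p x + p l * p x + p j * p y, by ring⟩
    · refine neg_one_pow_eq_of_even ⟨p i * p j + p i * p k + p j * p k + p y * p i + p y * p x +
        p j * p x + p j * p y, by ring⟩
  change w * ((∑ x, a i x * b x j) * (∑ y, a' k y * b' y l)) - _ • (z * (_ * _)) =
    _ • (w * (_ * _)) - _ • (z * (_ * _))
  rw [hl, hr]
  simp only [sub_mul, mul_sub, smul_sub, Finset.sum_sub_distrib]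
  congr 1
  · rw [Finset.sum_comm]
    refine Finset.sum_congr rfl fun y _ => Finset.sum_congr rfl fun x _ => ?_
    rw [← mul_assoc _ w, ← hw]
    simp only [smul_mul_assoc, smul_smul, mul_assoc, ← pow_add]
    congr 1
    refine neg_one_pow_eq_of_even ⟨p x * p k + p x * p y + p j * p k + p j * p y + p i * p k +
      p i * p y, by ring⟩
  · refine Finset.sum_congr rfl fun y _ => Finset.sum_congr rfl fun x _ => ?_
    rw [mul_smul_comm, ← mul_assoc _ z, ← hz]
    simp only [smul_mul_assoc, smul_smul, mul_assoc, ← pow_add]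
    congr 1
    refine neg_one_pow_eq_of_even ⟨p y * p k + p y * p x + p j * p k + p j * p x + p i * p y +
      p i * p k + p j * p y, by ring⟩

end RTT

section Coefficients

variable {A : Type*}

/-- A sum of antisymmetrised terms along an antidiagonal may be truncated. -/
theorem sum_range_min_antisymm [AddCommGroup A] (f : ℕ → ℕ → A) (hf : ∀ a b, f a b = -f b a)
    (h0 : ∀ a, f a a = 0) (r s : ℕ) :
    ∑ a ∈ Finset.range (min r s), f a (r + s - 1 - a) =
      ∑ a ∈ Finset.range r, f a (r + s - 1 - a) := by
  rcases le_total r s with h | h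
  · rw [min_eq_left h]
  · rw [min_eq_right h, ← Finset.sum_range_add_sum_Ico _ h, left_eq_add]
    refine Finset.sum_involution (fun a _ => r + s - 1 - a) ?_ ?_ ?_ ?_
    · intro a ha
      rw [Finset.mem_Ico] at ha
      rw [show r + s - 1 - (r + s - 1 - a) = a by omega, hf, neg_add_cancel]
    · intro a ha hne heq
      rw [heq] at hne
      exact hne (h0 a)
    · intro a ha
      rw [Finset.mem_Ico] at ha ⊢
      omega
    · intro a ha
      rw [Finset.mem_Ico] at ha
      omega

variable {ι : Type*} [Ring A] (p : ι → ℕ)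

/-- The supercommutator of `t i j r` and `t k l s`. -/
def superComm (t : ι → ι → ℕ → A) (i j k l : ι) (r s : ℕ) : A :=
  t i j r * t k l s - (-1 : ℤ) ^ ((p i + p j) * (p k + p l)) • (t k l s * t i j r)

/-- The defining relations of the super Yangian, for a family `t` of elements of a ring. -/
def YangianRel (t : ι → ι → ℕ → A) : Prop :=
  ∀ i j k l r s, superComm p t i j k l (r + 1) (s + 1) =
    (-1 : ℤ) ^ (p i * p j + p i * p k + p j * p k) •
      ∑ a ∈ Finset.range (min (r + 1) (s + 1)),
        (t k j a * t i l (r + s + 1 - a) - t k j (r + s + 1 - a) * t i l a)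

variable {p} {t : ι → ι → ℕ → A}

theorem superComm_zero_left [DecidableEq ι]
    (h0 : ∀ i j, t i j 0 = if i = j then 1 else 0) (i j k l : ι) (s : ℕ) :
    superComm p t i j k l 0 s = 0 := by
  rw [superComm, h0]
  split_ifs with h
  · subst h
    rw [Even.neg_one_pow (Even.mul_right ⟨_, rfl⟩ _)]
    simp
  · simp

theorem superComm_zero_right [DecidableEq ι]
    (h0 : ∀ i j, t i j 0 = if i = j then 1 else 0) (i j k l : ι) (r : ℕ) :
    superComm p t i j k l r 0 = 0 := by
  rw [superComm, h0]
  split_ifs with h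
  · subst h
    rw [Even.neg_one_pow (Even.mul_left ⟨_, rfl⟩ _)]
    simp
  · simp

theorem sum_range_min_yangian (t : ι → ι → ℕ → A) (i j k l : ι) (r s : ℕ) :
    ∑ a ∈ Finset.range (min r s),
        (t k j a * t i l (r + s - 1 - a) - t k j (r + s - 1 - a) * t i l a) =
      ∑ a ∈ Finset.range r,
        (t k j a * t i l (r + s - 1 - a) - t k j (r + s - 1 - a) * t i l a) :=
  sum_range_min_antisymm (fun a b => t k j a * t i l b - t k j b * t i l a)
    (fun _ _ => (neg_sub _ _).symm) (fun _ => sub_self _) r s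

/-- The Yangian relations are equivalent to their two-term recursive form. -/
theorem yangianRel_iff [DecidableEq ι] (h0 : ∀ i j, t i j 0 = if i = j then 1 else 0) :
    YangianRel p t ↔ ∀ i j k l r s,
      superComm p t i j k l (r + 1) s - superComm p t i j k l r (s + 1) =
        (-1 : ℤ) ^ (p i * p j + p i * p k + p j * p k) •
          (t k j r * t i l s - t k j s * t i l r) := by
  have key : YangianRel p t ↔ ∀ i j k l r s, superComm p t i j k l r s =
      (-1 : ℤ) ^ (p i * p j + p i * p k + p j * p k) • ∑ a ∈ Finset.range r,
        (t k j a * t i l (r + s - 1 - a) - t k j (r + s - 1 - a) * t i l a) := by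
    constructor
    · intro h i j k l r s
      rw [← sum_range_min_yangian]
      rcases r with - | r
      · simp [superComm_zero_left h0]
      rcases s with - | s
      · simp [superComm_zero_right h0]
      rw [h, show r + 1 + (s + 1) - 1 = r + s + 1 by omega]
    · intro h i j k l r s
      rw [h, ← sum_range_min_yangian, show r + 1 + (s + 1) - 1 = r + s + 1 by omega]
  rw [key]
  constructor
  · intro h i j k l r s
    rw [h, h, ← smul_sub, Finset.sum_range_succ, show r + 1 + s - 1 = r + s by omega,
      show r + (s + 1) - 1 = r + s by omega, add_sub_cancel_left, Nat.add_sub_cancel_left]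
  · intro h i j k l r
    induction r with
    | zero => intro s; simp [superComm_zero_left h0]
    | succ r ih =>
      intro s
      rw [← sub_add_cancel (superComm p t i j k l (r + 1) s) (superComm p t i j k l r (s + 1)),
        h, ih, ← smul_add, Finset.sum_range_succ, show r + 1 + s - 1 = r + s by omega,
        show r + (s + 1) - 1 = r + s by omega, Nat.add_sub_cancel_left]
      exact congrArg _ (add_comm _ _)

end Coefficients

section PowerSeries

open PowerSeries

variable {A : Type*} [Ring A]

/-- A power series in the first of two variables. -/
def inFst : A⟦X⟧ →+* A⟦X⟧⟦X⟧ := C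

/-- A power series in the second of two variables. -/
def inSnd : A⟦X⟧ →+* A⟦X⟧⟦X⟧ := PowerSeries.map C

theorem coeff_inFst_mul_inSnd (f g : A⟦X⟧) (r s : ℕ) :
    coeff r (coeff s (inFst f * inSnd g)) = coeff r f * coeff s g := by
  simp [inFst, inSnd]

theorem coeff_inSnd_mul_inFst (f g : A⟦X⟧) (r s : ℕ) :
    coeff r (coeff s (inSnd g * inFst f)) = coeff s g * coeff r f := by
  simp [inFst, inSnd]

theorem ext_coeff_coeff {f g : A⟦X⟧⟦X⟧} (h : ∀ r s, coeff r (coeff s f) = coeff r (coeff s g)) :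
    f = g :=
  PowerSeries.ext fun s => PowerSeries.ext fun r => h r s

theorem C_X_mul_comm (f : A⟦X⟧⟦X⟧) : C X * f = f * C (X : A⟦X⟧) :=
  PowerSeries.ext fun s => by simp [X_mul]

theorem coeff_succ_succ_X_mul_C_X_mul (f : A⟦X⟧⟦X⟧) (r s : ℕ) :
    coeff (r + 1) (coeff (s + 1) (X * C X * f)) = coeff r (coeff s f) := by
  rw [mul_assoc, coeff_succ_X_mul, coeff_C_mul, coeff_succ_X_mul]

theorem coeff_succ_succ_X_sub_C_X_mul (f : A⟦X⟧⟦X⟧) (r s : ℕ) :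
    coeff (r + 1) (coeff (s + 1) ((X - C X) * f)) =
      coeff (r + 1) (coeff s f) - coeff r (coeff (s + 1) f) := by
  rw [sub_mul, map_sub, map_sub, coeff_succ_X_mul, coeff_C_mul, coeff_succ_X_mul]

theorem coeff_succ_zero_X_sub_C_X_mul (f : A⟦X⟧⟦X⟧) (r : ℕ) :
    coeff (r + 1) (coeff 0 ((X - C X) * f)) = -coeff r (coeff 0 f) := by
  rw [sub_mul, map_sub, map_sub, coeff_zero_X_mul, coeff_C_mul, coeff_succ_X_mul, map_zero,
    zero_sub]

theorem coeff_zero_succ_X_sub_C_X_mul (f : A⟦X⟧⟦X⟧) (s : ℕ) :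
    coeff 0 (coeff (s + 1) ((X - C X) * f)) = coeff 0 (coeff s f) := by
  rw [sub_mul, map_sub, map_sub, coeff_succ_X_mul, coeff_C_mul, coeff_zero_X_mul, sub_zero]

variable {ι : Type*} {p : ι → ℕ}

/-- The Yangian relations are the RTT relation for generating series. -/
theorem rtt_iff_yangianRel [DecidableEq ι] {t : ι → ι → ℕ → A}
    (h0 : ∀ i j, t i j 0 = if i = j then 1 else 0) :
    RTT p (X - C X) (X * C X) (fun i j => inFst (mk (t i j))) (fun i j => inSnd (mk (t i j))) ↔
      YangianRel p t := by
  rw [yangianRel_iff h0]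
  have hS : ∀ i j k l r s, coeff r (coeff s (inFst (mk (t i j)) * inSnd (mk (t k l)) -
      (-1 : ℤ) ^ ((p i + p j) * (p k + p l)) • (inSnd (mk (t k l)) * inFst (mk (t i j))))) =
      superComm p t i j k l r s := by
    intro i j k l r s
    simp only [map_sub, map_zsmul, coeff_inFst_mul_inSnd, coeff_inSnd_mul_inFst, coeff_mk,
      superComm]
  have hT : ∀ i j k l r s, coeff r (coeff s ((-1 : ℤ) ^ (p i * p j + p i * p k + p j * p k) •
      (inFst (mk (t k j)) * inSnd (mk (t i l)) - inSnd (mk (t k j)) * inFst (mk (t i l))))) =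
      (-1 : ℤ) ^ (p i * p j + p i * p k + p j * p k) • (t k j r * t i l s - t k j s * t i l r) := by
    intro i j k l r s
    simp only [map_sub, map_zsmul, coeff_inFst_mul_inSnd, coeff_inSnd_mul_inFst, coeff_mk]
  have hR : ∀ (w z a b c d : A⟦X⟧⟦X⟧) (e e' : ℤ),
      w * a - e • (z * b) = e' • (w * c) - e • (z * d) ↔
        w * (a - e' • c) = z * (e • (b - d)) := by
    intro w z a b c d e e'
    simp only [mul_sub, mul_smul_comm, smul_sub]
    rw [sub_eq_sub_iff_add_eq_add, sub_eq_sub_iff_add_eq_add]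
    constructor
    · intro h
      rw [h, add_comm]
    · intro h
      rw [h, add_comm]
  simp only [RTT, hR]
  refine forall_congr' fun i => forall_congr' fun j => forall_congr' fun k => forall_congr' fun l =>
    ⟨fun h r s => ?_, fun h => ext_coeff_coeff fun r s => ?_⟩
  · have := congrArg (fun f => coeff (r + 1) (coeff (s + 1) f)) h
    simpa only [coeff_succ_succ_X_sub_C_X_mul, coeff_succ_succ_X_mul_C_X_mul, hS, hT] using this
  · rcases s with - | s
    · rcases r with - | r
      · simp [sub_mul, mul_assoc]
      · rw [coeff_succ_zero_X_sub_C_X_mul, hS, superComm_zero_right h0]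
        simp [mul_assoc]
    · rcases r with - | r
      · rw [coeff_zero_succ_X_sub_C_X_mul, hS, superComm_zero_left h0]
        simp [mul_assoc]
      · rw [coeff_succ_succ_X_sub_C_X_mul, coeff_succ_succ_X_mul_C_X_mul, hS, hS, hT, h]

/-- The coefficients of the product of two matrices of generating series. -/
def matMulCoeff [Fintype ι] (t t' : ι → ι → ℕ → A) (i j : ι) (r : ℕ) : A :=
  ∑ k, ∑ a ∈ Finset.range (r + 1), t i k a * t' k j (r - a)

theorem mk_matMulCoeff [Fintype ι] (t t' : ι → ι → ℕ → A) (i j : ι) :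
    mk (matMulCoeff t t' i j) = ∑ k, mk (t i k) * mk (t' k j) := by
  ext r
  simp only [coeff_mk, map_sum, coeff_mul, matMulCoeff]
  exact Finset.sum_congr rfl fun k _ =>
    (Finset.Nat.sum_antidiagonal_eq_sum_range_succ (fun a b => t i k a * t' k j b) r).symm

theorem matMulCoeff_zero [Fintype ι] [DecidableEq ι] {t t' : ι → ι → ℕ → A}
    (h0 : ∀ i j, t i j 0 = if i = j then 1 else 0)
    (h0' : ∀ i j, t' i j 0 = if i = j then 1 else 0) (i j : ι) :
    matMulCoeff t t' i j 0 = if i = j then 1 else 0 := by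
  simp [matMulCoeff, h0, h0']

/-- The product of two supercommuting solutions of the Yangian relations is a solution. -/
theorem YangianRel.matMulCoeff [Fintype ι] [DecidableEq ι] {t t' : ι → ι → ℕ → A}
    (h0 : ∀ i j, t i j 0 = if i = j then 1 else 0)
    (h0' : ∀ i j, t' i j 0 = if i = j then 1 else 0)
    (ht : YangianRel p t) (ht' : YangianRel p t')
    (h : ∀ i j k l r s, t' i j r * t k l s =
      (-1 : ℤ) ^ ((p i + p j) * (p k + p l)) • (t k l s * t' i j r)) :
    YangianRel p (matMulCoeff t t') := by
  rw [← rtt_iff_yangianRel (matMulCoeff_zero h0 h0')]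
  simp only [mk_matMulCoeff, map_sum, map_mul]
  refine RTT.mul p ?_ ?_ ((rtt_iff_yangianRel h0).2 ht) ((rtt_iff_yangianRel h0').2 ht') ?_ ?_
  · intro f
    rw [sub_mul, mul_sub, X_mul, C_X_mul_comm]
  · intro f
    rw [mul_assoc, C_X_mul_comm, ← mul_assoc, X_mul, mul_assoc, X_mul]
  · refine fun i j k l => ext_coeff_coeff fun r s => ?_
    simp only [map_zsmul, coeff_inFst_mul_inSnd, coeff_inSnd_mul_inFst, coeff_mk, h]
  · refine fun i j k l => ext_coeff_coeff fun r s => ?_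
    simp only [map_zsmul, coeff_inFst_mul_inSnd, coeff_inSnd_mul_inFst, coeff_mk, h]

end PowerSeries

section Coproduct

theorem neg_one_pow_mul_eq_zsmul {A : Type*} [Ring A] (e : ℕ) (x : A) :
    (-1 : A) ^ e * x = (-1 : ℤ) ^ e • x := by
  simp [zsmul_eq_mul]

variable (m n : ℕ)

/-- The element `t_{ij}^{(r)} ⊗ 1` of the graded tensor square. -/
def tYL (i j : Fin (m + n)) (r : ℕ) : YY m n := RingQuot.mkAlgHom ℂ (YYRel m n) (tL m n i j r)

/-- The element `1 ⊗ t_{ij}^{(r)}` of the graded tensor square. -/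
def tYR (i j : Fin (m + n)) (r : ℕ) : YY m n := RingQuot.mkAlgHom ℂ (YYRel m n) (tR m n i j r)

theorem tYL_zero (i j : Fin (m + n)) : tYL m n i j 0 = if i = j then 1 else 0 := by
  rw [tYL, tL]
  split_ifs <;> simp

theorem tYR_zero (i j : Fin (m + n)) : tYR m n i j 0 = if i = j then 1 else 0 := by
  rw [tYR, tR]
  split_ifs <;> simp

theorem yangianRel_tYL : YangianRel (par m) (tYL m n) := by
  intro i j k l r s
  have := RingQuot.mkAlgHom_rel ℂ (YYRel.left i j k l r s)
  simp only [map_sub, map_mul, map_sum, map_zsmul, neg_one_pow_mul_eq_zsmul] at this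
  exact this

theorem yangianRel_tYR : YangianRel (par m) (tYR m n) := by
  intro i j k l r s
  have := RingQuot.mkAlgHom_rel ℂ (YYRel.right i j k l r s)
  simp only [map_sub, map_mul, map_sum, map_zsmul, neg_one_pow_mul_eq_zsmul] at this
  exact this

theorem tYR_mul_tYL (i j k l : Fin (m + n)) (r s : ℕ) :
    tYR m n i j r * tYL m n k l s =
      (-1 : ℤ) ^ ((par m i + par m j) * (par m k + par m l)) •
        (tYL m n k l s * tYR m n i j r) := by
  rcases r with - | r
  · rw [tYR_zero]
    split_ifs with h
    · subst h
      rw [Even.neg_one_pow (Even.mul_right ⟨_, rfl⟩ _)]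
      simp
    · simp
  rcases s with - | s
  · rw [tYL_zero]
    split_ifs with h
    · subst h
      rw [Even.neg_one_pow (Even.mul_left ⟨_, rfl⟩ _)]
      simp
    · simp
  have := RingQuot.mkAlgHom_rel ℂ (YYRel.mixed (m := m) (n := n) (k, l, s) (i, j, r))
  rw [mul_comm (par m i + par m j)]
  simp only [map_mul, map_zsmul, neg_one_pow_mul_eq_zsmul] at this
  exact this

theorem sum_tensorElem (i j : Fin (m + n)) (r : ℕ) :
    ∑ k : Fin (m + n), ∑ a ∈ Finset.range (r + 2), tensorElem m n i k k j a (r + 1 - a) =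
      matMulCoeff (tYL m n) (tYR m n) i j (r + 1) := by
  simp only [tensorElem, map_mul]
  rfl

/-- The coproduct on the free algebra. -/
def coproductFree : F m n →ₐ[ℂ] YY m n :=
  FreeAlgebra.lift ℂ fun g => matMulCoeff (tYL m n) (tYR m n) g.1 g.2.1 (g.2.2 + 1)

theorem coproductFree_tF (i j : Fin (m + n)) (r : ℕ) :
    coproductFree m n (tF m n i j r) = matMulCoeff (tYL m n) (tYR m n) i j r := by
  rcases r with - | r
  · rw [matMulCoeff_zero (tYL_zero m n) (tYR_zero m n), tF]
    split_ifs <;> simp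
  · rw [tF, coproductFree, FreeAlgebra.lift_ι_apply]

theorem coproductFree_rel ⦃x y : F m n⦄ (h : YRel m n x y) :
    coproductFree m n x = coproductFree m n y := by
  obtain ⟨i, j, k, l, r, s⟩ := h
  have := YangianRel.matMulCoeff (tYL_zero m n) (tYR_zero m n) (yangianRel_tYL m n)
    (yangianRel_tYR m n) (tYR_mul_tYL m n) i j k l r s
  simpa only [superComm, map_sub, map_mul, map_sum, map_zsmul, neg_one_pow_mul_eq_zsmul,
    coproductFree_tF] using this

end Coproduct

theorem statement16 (m n : ℕ) (hN : 1 ≤ m + n) :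
    ∃! D : Y m n →ₐ[ℂ] YY m n,
      ∀ (i j : Fin (m + n)) (r : ℕ),
        D (tY m n i j (r + 1)) =
          ∑ k : Fin (m + n), ∑ a ∈ Finset.range (r + 2),
            tensorElem m n i k k j a (r + 1 - a) := by
  simp only [sum_tensorElem]
  refine ⟨RingQuot.liftAlgHom ℂ ⟨coproductFree m n, coproductFree_rel m n⟩, fun i j r => ?_,
    fun D hD => ?_⟩
  · rw [tY, RingQuot.liftAlgHom_mkAlgHom_apply, coproductFree_tF]
  · refine RingQuot.ringQuot_ext' _ _ _ (FreeAlgebra.hom_ext (funext fun ⟨i, j, r⟩ => ?_))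
    change D (tY m n i j (r + 1)) = RingQuot.liftAlgHom ℂ _ (tY m n i j (r + 1))
    rw [hD, tY, RingQuot.liftAlgHom_mkAlgHom_apply, coproductFree_tF]
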